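/- Let 1 ≤ p < ∞, let (X,𝒜,μ) be a probability space, let S,T : X → X be commuting, invertible, measure-preserving, ergodic transformations, and let {R_n}_{n∈ℕ} be a p-good process. Then for every f ∈ L^p(X), lim_{n→∞} M_n f(x) = ∫_X f dμ for almost every x ∈ X. -/

import Mathlib

open MeasureTheory Filter Topology Set
open scoped ENNReal Pointwise BigOperators

noncomputable section

/-- A (possibly tilted) closed rectangle in the plane, described by a corner,
an angle, and two positive side lengths. -/
structure Rect where
  corner : ℝ × ℝ
  angle : ℝ
  len1 : ℝ
  len2 : ℝ
  len1_pos : 0 < len1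
  len2_pos : 0 < len2

namespace Rect

/-- The set of points of a rectangle. -/
def carrier (R : Rect) : Set (ℝ × ℝ) :=
  {p | ∃ s t : ℝ, s ∈ Icc (0 : ℝ) R.len1 ∧ t ∈ Icc (0 : ℝ) R.len2 ∧
    p = R.corner + s • (Real.cos R.angle, Real.sin R.angle) +
      t • (-Real.sin R.angle, Real.cos R.angle)}

/-- `l(R)`: the length of the shortest side. -/
def shortSide (R : Rect) : ℝ := min R.len1 R.len2

/-- `L(R)`: the length of the longest side. -/
def longSide (R : Rect) : ℝ := max R.len1 R.len2

/-- The slope of a rectangle: the tangent of the angle formed between its longest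
side and the horizontal axis (canonical choice for squares). -/
def slope (R : Rect) : ℝ :=
  if R.len2 ≤ R.len1 then Real.tan R.angle else Real.tan (R.angle + Real.pi / 2)

end Rect

/-- The integer lattice points lying in a planar set. -/
def latticePts (F : Set (ℝ × ℝ)) : Set (ℤ × ℤ) := {p | ((p.1 : ℝ), (p.2 : ℝ)) ∈ F}

/-- `#(F ∩ ℤ²)`: the number of integer lattice points in `F`. -/
def latticeCount (F : Set (ℝ × ℝ)) : ℕ := (latticePts F).ncard

/-- A process: a sequence of rectangles containing `(0,0)` whose shortest sides
tend to infinity. -/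
def IsProcess (R : ℕ → Rect) : Prop :=
  (∀ n, ((0 : ℝ), (0 : ℝ)) ∈ (R n).carrier) ∧
    Tendsto (fun n => (R n).shortSide) atTop atTop

variable {X : Type*} [MeasurableSpace X]

/-- The ergodic average `M_R f(x) = (1/#(R ∩ ℤ²)) ∑_{(i,j) ∈ R ∩ ℤ²} f(S^i T^j x)`. -/
def ergAvg (S T : X ≃ᵐ X) (R : Rect) (f : X → ℝ) (x : X) : ℝ :=
  (latticeCount R.carrier : ℝ)⁻¹ *
    ∑ᶠ p ∈ latticePts R.carrier, f ((S.toEquiv ^ p.1) ((T.toEquiv ^ p.2) x))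

/-- The maximal operator `M* f = sup_n M_n |f|`. -/
def maxOp (S T : X ≃ᵐ X) (R : ℕ → Rect) (f : X → ℝ) (x : X) : ℝ≥0∞ :=
  ⨆ n, ENNReal.ofReal (ergAvg S T (R n) (fun y => |f y|) x)

/-- The maximal operator `M'* f = sup_n |M_n f|`. -/
def maxOpAbs (S T : X ≃ᵐ X) (R : ℕ → Rect) (f : X → ℝ) (x : X) : ℝ≥0∞ :=
  ⨆ n, ENNReal.ofReal |ergAvg S T (R n) f x|

/-- `S, T` form a pair of commuting, invertible, measure-preserving, ergodic
transformations of the probability space `(X, μ)`. -/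
structure ErgodicSetup (μ : Measure X) (S T : X ≃ᵐ X) : Prop where
  prob : IsProbabilityMeasure μ
  measPres_S : MeasurePreserving (⇑S) μ μ
  measPres_T : MeasurePreserving (⇑T) μ μ
  comm : ∀ x, S (T x) = T (S x)
  erg_S : Ergodic (⇑S) μ
  erg_T : Ergodic (⇑T) μ

/-- An operator `M` is of weak-type `(p,p)`. -/
def IsWeakType (μ : Measure X) (M : (X → ℝ) → X → ℝ≥0∞) (p : ℝ) : Prop :=
  ∃ C : ℝ, 0 < C ∧ ∀ f : X → ℝ, MemLp f (ENNReal.ofReal p) μ → ∀ lam : ℝ, 0 < lam →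
    μ {x | ENNReal.ofReal lam < M f x} ≤
      ENNReal.ofReal (C * ((eLpNorm f (ENNReal.ofReal p) μ).toReal / lam) ^ p)

/-- The averages `M_n f` converge almost everywhere. -/
def AEConverges (μ : Measure X) (S T : X ≃ᵐ X) (R : ℕ → Rect) (f : X → ℝ) : Prop :=
  ∀ᵐ x ∂μ, ∃ L : ℝ, Tendsto (fun n => ergAvg S T (R n) f x) atTop (𝓝 L)

/-- The maximal operator `M*` satisfies a Tauberian condition. -/
def ErgTauberian (μ : Measure X) (S T : X ≃ᵐ X) (R : ℕ → Rect) : Prop :=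
  ∀ lam : ℝ, 0 < lam → lam < 1 → ∃ C : ℝ, 0 < C ∧ ∀ A : Set X, MeasurableSet A →
    0 < μ A → μ A < ⊤ →
    μ {x | ENNReal.ofReal lam < maxOp S T R (A.indicator fun _ => (1 : ℝ)) x} ≤
      ENNReal.ofReal C * μ A

/-- A `p`-good process: on every probability space with a commuting, invertible,
measure-preserving, ergodic pair, the averages converge a.e. for every `f ∈ L^p`. -/
def IsGoodProcess (R : ℕ → Rect) (p : ℝ≥0∞) : Prop :=
  ∀ (Y : Type) [MeasurableSpace Y], ∀ (μ : Measure Y) (S T : Y ≃ᵐ Y),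
    ErgodicSetup μ S T → ∀ f : Y → ℝ, MemLp f p μ → AEConverges μ S T R f

/-- The discrete average `A_R φ(k,l)`. -/
def discAvg (R : Rect) (φ : ℤ × ℤ → ℝ) (kl : ℤ × ℤ) : ℝ :=
  (latticeCount R.carrier : ℝ)⁻¹ *
    ∑ᶠ p ∈ latticePts R.carrier, φ (kl.1 + p.1, kl.2 + p.2)

/-- The discrete maximal operator `A* φ = sup_n A_n |φ|`. -/
def discMaxOp (R : ℕ → Rect) (φ : ℤ × ℤ → ℝ) (kl : ℤ × ℤ) : ℝ≥0∞ :=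
  ⨆ n, ENNReal.ofReal (discAvg (R n) (fun q => |φ q|) kl)

/-- The `N`-truncated discrete maximal operator `A*_N φ = sup_{n ≥ N} A_n |φ|`. -/
def discMaxOpFrom (R : ℕ → Rect) (N : ℕ) (φ : ℤ × ℤ → ℝ) (kl : ℤ × ℤ) : ℝ≥0∞ :=
  ⨆ n, ⨆ (_ : N ≤ n), ENNReal.ofReal (discAvg (R n) (fun q => |φ q|) kl)

def lpSum (φ : ℤ × ℤ → ℝ) (p : ℝ) : ℝ≥0∞ := ∑' q : ℤ × ℤ, ENNReal.ofReal (|φ q| ^ p)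

/-- `φ ∈ ℓ^p(ℤ²)`. -/
def Memlp (φ : ℤ × ℤ → ℝ) (p : ℝ) : Prop := lpSum φ p < ⊤

/-- The `ℓ^p(ℤ²)` norm. -/
def lpNorm (φ : ℤ × ℤ → ℝ) (p : ℝ) : ℝ≥0∞ := lpSum φ p ^ (1 / p)

/-- The `ℓ^p(ℤ²)` norm of an `ℝ≥0∞`-valued function. -/
def lpNormE (F : ℤ × ℤ → ℝ≥0∞) (p : ℝ) : ℝ≥0∞ := (∑' q : ℤ × ℤ, F q ^ p) ^ (1 / p)

/-- A discrete operator `B` is of weak-type `(p,p)` on `ℓ^p(ℤ²)`. -/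
def IsDiscWeakType (B : (ℤ × ℤ → ℝ) → ℤ × ℤ → ℝ≥0∞) (p : ℝ) : Prop :=
  ∃ C : ℝ, 0 < C ∧ ∀ φ : ℤ × ℤ → ℝ, Memlp φ p → ∀ lam : ℝ, 0 < lam →
    Measure.count {kl : ℤ × ℤ | ENNReal.ofReal lam ≤ B φ kl} ≤
      ENNReal.ofReal (C * ((lpNorm φ p).toReal / lam) ^ p)

/-- The discrete maximal operator associated with `R` satisfies a Tauberian condition. -/
def DiscTauberian (R : ℕ → Rect) : Prop :=
  ∀ lam : ℝ, 0 < lam → ∃ C : ℝ, 0 < C ∧ ∀ E : Finset (ℤ × ℤ), E.Nonempty →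
    Measure.count {kl : ℤ × ℤ |
        ENNReal.ofReal lam ≤ discMaxOp R (fun q => if q ∈ E then (1 : ℝ) else 0) kl} ≤
      ENNReal.ofReal C * (E.card : ℝ≥0∞)

/-- Vertices and sets of the geometric construction 1 (with `A = (1,0)`,
`B = (0,b)`, `C = (0,c)`). -/
def ptA : ℝ × ℝ := (1, 0)
def ptB (b : ℝ) : ℝ × ℝ := (0, b)
def ptC (c : ℝ) : ℝ × ℝ := (0, c)
def ptB' (b : ℝ) : ℝ × ℝ := ptA + (3 / 2 : ℝ) • (ptB b - ptA)
def ptC' (c : ℝ) : ℝ × ℝ := ptA + (3 / 2 : ℝ) • (ptC c - ptA)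

/-- The full triangle `ABC`. -/
def triABC (b c : ℝ) : Set (ℝ × ℝ) := convexHull ℝ {ptA, ptB b, ptC c}

/-- The full trapezium `BCC'B'`. -/
def trapV (b c : ℝ) : Set (ℝ × ℝ) := convexHull ℝ {ptB b, ptC c, ptC' c, ptB' b}

/-- The rectangle `P`: the smallest rectangle having `AC'` as one of its sides and
containing the triangle `AB'C'`, translated so that its center is the origin.
Its sides have directions `(-1,c)/√(1+c²)` and `(c,1)/√(1+c²)`, with half-lengths
`(3/4)√(1+c²)` and `(3/4)(b-c)/√(1+c²)`. -/
def rectP (b c : ℝ) : Set (ℝ × ℝ) :=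
  {p : ℝ × ℝ |
    |(-p.1 + c * p.2)| / Real.sqrt (1 + c ^ 2) ≤ (3 / 4) * Real.sqrt (1 + c ^ 2) ∧
    |(c * p.1 + p.2)| / Real.sqrt (1 + c ^ 2) ≤ (3 / 4) * (b - c) / Real.sqrt (1 + c ^ 2)}

/-- Horizontal translation of a planar set by `t`. -/
def hTranslate (t : ℝ) (F : Set (ℝ × ℝ)) : Set (ℝ × ℝ) :=
  (fun p : ℝ × ℝ => (p.1 + t, p.2)) '' F

/-- The triangle `Δ_k` with vertices `A = (0,1)`, `B_{k-1} = (u_{k-1}, 0)`,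
`B_k = (u_k, 0)`. -/
def triPerron (u : ℕ → ℝ) (k : ℕ) : Set (ℝ × ℝ) :=
  convexHull ℝ {((0 : ℝ), (1 : ℝ)), ((u (k - 1) : ℝ), (0 : ℝ)), ((u k : ℝ), (0 : ℝ))}

/-- The symmetric difference `Δ_n := R_n △ (R_n + (0,1))`. -/
def symmDiffTranslate (R : Rect) : Set (ℝ × ℝ) :=
  symmDiff R.carrier ((fun q : ℝ × ℝ => q + ((0 : ℝ), (1 : ℝ))) '' R.carrier)


def rA (R : Rect) (q : ℝ × ℝ) : ℝ :=
  (q.1 - R.corner.1) * Real.cos R.angle + (q.2 - R.corner.2) * Real.sin R.angle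
def rB (R : Rect) (q : ℝ × ℝ) : ℝ :=
  -(q.1 - R.corner.1) * Real.sin R.angle + (q.2 - R.corner.2) * Real.cos R.angle

lemma mem_carrier_iff (R : Rect) (q : ℝ × ℝ) :
    q ∈ R.carrier ↔ (0 ≤ rA R q ∧ rA R q ≤ R.len1) ∧ (0 ≤ rB R q ∧ rB R q ≤ R.len2) := by
  have h := Real.cos_sq_add_sin_sq R.angle
  constructor
  · rintro ⟨s, t, hs, ht, rfl⟩
    have h1 : rA R (R.corner + s • (Real.cos R.angle, Real.sin R.angle) +
      t • (-Real.sin R.angle, Real.cos R.angle)) = s := by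
      simp [rA]; linear_combination s * h
    have h2 : rB R (R.corner + s • (Real.cos R.angle, Real.sin R.angle) +
      t • (-Real.sin R.angle, Real.cos R.angle)) = t := by
      simp [rB]; linear_combination t * h
    rw [h1, h2]; exact ⟨hs, ht⟩
  · rintro ⟨h1, h2⟩
    refine ⟨rA R q, rB R q, h1, h2, ?_⟩
    ext
    · simp [rA, rB]; linear_combination -(q.1 - R.corner.1) * h
    · simp [rA, rB]; linear_combination -(q.2 - R.corner.2) * h

lemma mem_lattice_iff (R : Rect) (q : ℤ × ℤ) :
    q ∈ latticePts R.carrier ↔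
      (0 ≤ rA R ((q.1:ℝ),(q.2:ℝ)) ∧ rA R ((q.1:ℝ),(q.2:ℝ)) ≤ R.len1) ∧
      (0 ≤ rB R ((q.1:ℝ),(q.2:ℝ)) ∧ rB R ((q.1:ℝ),(q.2:ℝ)) ≤ R.len2) :=
  mem_carrier_iff R _

lemma lattice_finite (R : Rect) : (latticePts R.carrier).Finite := by
  apply (((Set.finite_Icc ⌊R.corner.1 - R.len1 - R.len2⌋ ⌈R.corner.1 + R.len1 + R.len2⌉).prod
    (Set.finite_Icc ⌊R.corner.2 - R.len1 - R.len2⌋ ⌈R.corner.2 + R.len1 + R.len2⌉))).subset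
  rintro ⟨i, j⟩ ⟨s, t, hs, ht, h⟩
  have h1 := congrArg Prod.fst h
  have h2 := congrArg Prod.snd h
  simp at h1 h2
  have c1 := Real.cos_le_one R.angle
  have c2 := Real.neg_one_le_cos R.angle
  have s1 := Real.sin_le_one R.angle
  have s2 := Real.neg_one_le_sin R.angle
  obtain ⟨hs1, hs2⟩ := hs
  obtain ⟨ht1, ht2⟩ := ht
  have a1 : s * Real.cos R.angle ≤ s := by nlinarith
  have a2 : -s ≤ s * Real.cos R.angle := by nlinarith
  have a3 : s * Real.sin R.angle ≤ s := by nlinarith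
  have a4 : -s ≤ s * Real.sin R.angle := by nlinarith
  have b1 : t * Real.cos R.angle ≤ t := by nlinarith
  have b2 : -t ≤ t * Real.cos R.angle := by nlinarith
  have b3 : t * Real.sin R.angle ≤ t := by nlinarith
  have b4 : -t ≤ t * Real.sin R.angle := by nlinarith
  simp only [Set.mem_prod, Set.mem_Icc]
  refine ⟨⟨?_, ?_⟩, ⟨?_, ?_⟩⟩
  · have : (⌊R.corner.1 - R.len1 - R.len2⌋ : ℝ) ≤ i := (Int.floor_le _).trans (by linarith)
    exact_mod_cast this
  · have : (i : ℝ) ≤ ⌈R.corner.1 + R.len1 + R.len2⌉ := le_trans (by linarith) (Int.le_ceil _)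
    exact_mod_cast this
  · have : (⌊R.corner.2 - R.len1 - R.len2⌋ : ℝ) ≤ j := (Int.floor_le _).trans (by linarith)
    exact_mod_cast this
  · have : (j : ℝ) ≤ ⌈R.corner.2 + R.len1 + R.len2⌉ := le_trans (by linarith) (Int.le_ceil _)
    exact_mod_cast this

def FF (R : Rect) : Finset (ℤ × ℤ) := (lattice_finite R).toFinset

lemma mem_FF (R : Rect) (q : ℤ × ℤ) : q ∈ FF R ↔ q ∈ latticePts R.carrier := by simp [FF]

/-- top boundary points -/
def BB (R : Rect) : Finset (ℤ × ℤ) := (FF R).filter (fun q => (q.1, q.2 + 1) ∉ FF R)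

lemma conv_aux {a b s : ℝ} {m n : ℤ} (hmn : m < n) (h1 : 0 ≤ a + m * s) (h2 : a + m * s ≤ b)
    (h3 : 0 ≤ a + n * s) (h4 : a + n * s ≤ b) :
    0 ≤ a + (m + 1) * s ∧ a + (m + 1) * s ≤ b := by
  have h : (m : ℝ) + 1 ≤ n := by exact_mod_cast hmn
  rcases le_total 0 s with hs | hs
  · constructor <;> nlinarith
  · constructor <;> nlinarith

lemma BB_lt (R : Rect) (q q' : ℤ × ℤ) (hq : q ∈ BB R) (hq' : q' ∈ BB R) (h : q.1 = q'.1)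
    (hlt : q.2 < q'.2) : False := by
  simp only [BB, Finset.mem_filter, mem_FF, mem_lattice_iff] at hq hq'
  obtain ⟨i, m⟩ := q
  obtain ⟨i', n⟩ := q'
  simp only at h hlt
  subst h
  obtain ⟨⟨⟨p1, p2⟩, p3, p4⟩, hn⟩ := hq
  obtain ⟨⟨⟨r1, r2⟩, r3, r4⟩, -⟩ := hq'
  apply hn
  simp only [rA, rB] at *
  have e1 := @conv_aux (((i:ℝ) - R.corner.1) * Real.cos R.angle - R.corner.2 * Real.sin R.angle)
    R.len1 (Real.sin R.angle) m n hlt (by linarith) (by linarith) (by linarith) (by linarith)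
  have e2 := @conv_aux (-((i:ℝ) - R.corner.1) * Real.sin R.angle - R.corner.2 * Real.cos R.angle)
    R.len2 (Real.cos R.angle) m n hlt (by linarith) (by linarith) (by linarith) (by linarith)
  push_cast
  refine ⟨⟨?_, ?_⟩, ?_, ?_⟩ <;> linarith [e1.1, e1.2, e2.1, e2.2]

lemma BB_inj (R : Rect) (q q' : ℤ × ℤ) (hq : q ∈ BB R) (hq' : q' ∈ BB R) (h : q.1 = q'.1) :
    q = q' := by
  rcases lt_trichotomy q.2 q'.2 with h1 | h1 | h1
  · exact (BB_lt R q q' hq hq' h h1).elim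
  · exact Prod.ext h h1
  · exact (BB_lt R q' q hq' hq h.symm h1).elim

lemma exists_w (θ l σ τ : ℝ) (K : ℕ) (hl : 4 * ((K:ℝ) + 1) ≤ l) (hσ : σ = 1 ∨ σ = -1)
    (hτ : τ = 1 ∨ τ = -1) : ∃ w : ℤ × ℤ, ∀ k : ℕ, k < K →
      (0 ≤ σ * (w.1 * Real.cos θ + (w.2 + k) * Real.sin θ) ∧
        σ * (w.1 * Real.cos θ + (w.2 + k) * Real.sin θ) ≤ l / 2) ∧
      (0 ≤ τ * (-w.1 * Real.sin θ + (w.2 + k) * Real.cos θ) ∧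
        τ * (-w.1 * Real.sin θ + (w.2 + k) * Real.cos θ) ≤ l / 2) := by
  have h := Real.cos_sq_add_sin_sq θ
  have c1 := Real.cos_le_one θ
  have c2 := Real.neg_one_le_cos θ
  have s1 := Real.sin_le_one θ
  have s2 := Real.neg_one_le_sin θ
  set c := Real.cos θ
  set s := Real.sin θ
  set z1 := l / 4 * (σ * c - τ * s) with hz1
  set z2 := l / 4 * (σ * s + τ * c) with hz2
  refine ⟨(⌊z1⌋, ⌊z2⌋), fun k hk => ?_⟩
  have f1 := Int.floor_le z1
  have f2 := Int.floor_le z2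
  have g1 := Int.lt_floor_add_one z1
  have g2 := Int.lt_floor_add_one z2
  have hk' : (k : ℝ) + 1 ≤ K := by exact_mod_cast hk
  have hk0 : (0 : ℝ) ≤ k := by positivity
  simp only
  obtain ⟨e1, he1⟩ : ∃ e1, e1 = (⌊z1⌋ : ℝ) - z1 := ⟨_, rfl⟩
  obtain ⟨e2, he2⟩ : ∃ e2, e2 = (⌊z2⌋ : ℝ) + k - z2 := ⟨_, rfl⟩
  have E1 : |e1| ≤ 1 := abs_le.2 ⟨by linarith, by linarith⟩
  have E2 : |e2| ≤ K := abs_le.2 ⟨by linarith, by linarith⟩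
  have hc : |c| ≤ 1 := abs_le.2 ⟨c2, c1⟩
  have hs : |s| ≤ 1 := abs_le.2 ⟨s2, s1⟩
  have key : ∀ x y : ℝ, |x| ≤ 1 → |y| ≤ 1 → |e1 * x + e2 * y| ≤ l / 4 := by
    intro x y hx hy
    calc |e1 * x + e2 * y| ≤ |e1 * x| + |e2 * y| := abs_add_le _ _
      _ = |e1| * |x| + |e2| * |y| := by rw [abs_mul, abs_mul]
      _ ≤ 1 * 1 + K * 1 := by gcongr
      _ ≤ l / 4 := by linarith
  have k1 := abs_le.1 (key c s hc hs)
  have k2 := abs_le.1 (key (-s) c (by rwa [abs_neg]) hc)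
  have i1 : (⌊z1⌋ : ℝ) * c + (⌊z2⌋ + k) * s = l / 4 * σ + (e1 * c + e2 * s) := by
    rw [he1, he2, hz1, hz2]; linear_combination (l / 4 * σ) * h
  have i2 : -(⌊z1⌋ : ℝ) * s + (⌊z2⌋ + k) * c = l / 4 * τ + (e1 * (-s) + e2 * c) := by
    rw [he1, he2, hz1, hz2]; linear_combination (l / 4 * τ) * h
  rw [i1, i2]
  rcases hσ with rfl | rfl <;> rcases hτ with rfl | rfl <;>
    refine ⟨⟨?_, ?_⟩, ?_, ?_⟩ <;> linarith [k1.1, k1.2, k2.1, k2.2]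

def BQ (R : Rect) (σ τ : ℝ) : Finset (ℤ × ℤ) := by
  classical
  exact (BB R).filter (fun q => σ * (2 * rA R ((q.1:ℝ),(q.2:ℝ)) - R.len1) ≤ 0 ∧
    τ * (2 * rB R ((q.1:ℝ),(q.2:ℝ)) - R.len2) ≤ 0)

lemma BQ_card (R : Rect) (σ τ : ℝ) (K : ℕ) (hl : 4 * ((K:ℝ) + 1) ≤ R.shortSide)
    (hσ : σ = 1 ∨ σ = -1) (hτ : τ = 1 ∨ τ = -1) : (BQ R σ τ).card * K ≤ (FF R).card := by
  obtain ⟨w, hw⟩ := exists_w R.angle R.shortSide σ τ K hl hσ hτ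
  have l1 : R.shortSide ≤ R.len1 := min_le_left _ _
  have l2 : R.shortSide ≤ R.len2 := min_le_right _ _
  rw [← Finset.card_range K, ← Finset.card_product]
  apply Finset.card_le_card_of_injOn (fun x => (x.1.1 + w.1, x.1.2 + (w.2 + (x.2 : ℤ))))
  · rintro ⟨q, k⟩ hx
    simp only [Finset.coe_product, Set.mem_prod, Finset.mem_coe, Finset.mem_range] at hx
    obtain ⟨hq, hk⟩ := hx
    have hw' := hw k hk
    simp only [BQ, BB, Finset.mem_filter, mem_FF, mem_lattice_iff] at hq
    simp only [Finset.mem_coe, mem_FF, mem_lattice_iff]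
    obtain ⟨⟨⟨⟨p1, p2⟩, p3, p4⟩, -⟩, p5, p6⟩ := hq
    obtain ⟨⟨w1, w2⟩, w3, w4⟩ := hw'
    have i1 : rA R (((q.1 + w.1 : ℤ) : ℝ), ((q.2 + (w.2 + (k:ℤ)) : ℤ) : ℝ)) =
      rA R ((q.1:ℝ),(q.2:ℝ)) + (w.1 * Real.cos R.angle + (w.2 + k) * Real.sin R.angle) := by
      simp only [rA]; push_cast; ring
    have i2 : rB R (((q.1 + w.1 : ℤ) : ℝ), ((q.2 + (w.2 + (k:ℤ)) : ℤ) : ℝ)) =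
      rB R ((q.1:ℝ),(q.2:ℝ)) + (-w.1 * Real.sin R.angle + (w.2 + k) * Real.cos R.angle) := by
      simp only [rB]; push_cast; ring
    rw [i1, i2]
    rcases hσ with rfl | rfl <;> rcases hτ with rfl | rfl <;>
      refine ⟨⟨?_, ?_⟩, ?_, ?_⟩ <;> linarith
  · rintro ⟨q, k⟩ hx ⟨q', k'⟩ hx' h
    simp only [Finset.coe_product, Set.mem_prod, Finset.mem_coe, Finset.mem_range, BQ,
      Finset.mem_filter] at hx hx'
    simp only [Prod.mk.injEq] at h
    have : q = q' := BB_inj R q q' hx.1.1 hx'.1.1 (by omega)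
    subst this
    have : k = k' := by omega
    rw [this]

lemma BB_card (R : Rect) (K : ℕ) (hl : 4 * ((K:ℝ) + 1) ≤ R.shortSide) :
    (BB R).card * K ≤ 4 * (FF R).card := by
  classical
  have hsub : BB R ⊆ (BQ R 1 1 ∪ BQ R 1 (-1)) ∪ (BQ R (-1) 1 ∪ BQ R (-1) (-1)) := by
    intro q hq
    simp only [BQ, Finset.mem_union, Finset.mem_filter, hq, true_and]
    rcases le_total (2 * rA R ((q.1:ℝ),(q.2:ℝ)) - R.len1) 0 with h1 | h1 <;>
    rcases le_total (2 * rB R ((q.1:ℝ),(q.2:ℝ)) - R.len2) 0 with h2 | h2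
    · exact Or.inl (Or.inl ⟨by linarith, by linarith⟩)
    · exact Or.inl (Or.inr ⟨by linarith, by linarith⟩)
    · exact Or.inr (Or.inl ⟨by linarith, by linarith⟩)
    · exact Or.inr (Or.inr ⟨by linarith, by linarith⟩)
  have h0 := Finset.card_le_card hsub
  have h1 := Finset.card_union_le (BQ R 1 1 ∪ BQ R 1 (-1)) (BQ R (-1) 1 ∪ BQ R (-1) (-1))
  have h2 := Finset.card_union_le (BQ R 1 1) (BQ R 1 (-1))
  have h3 := Finset.card_union_le (BQ R (-1) 1) (BQ R (-1) (-1))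
  have a1 := BQ_card R 1 1 K hl (Or.inl rfl) (Or.inl rfl)
  have a2 := BQ_card R 1 (-1) K hl (Or.inl rfl) (Or.inr rfl)
  have a3 := BQ_card R (-1) 1 K hl (Or.inr rfl) (Or.inl rfl)
  have a4 := BQ_card R (-1) (-1) K hl (Or.inr rfl) (Or.inr rfl)
  have : (BB R).card ≤ (BQ R 1 1).card + (BQ R 1 (-1)).card + (BQ R (-1) 1).card
    + (BQ R (-1) (-1)).card := by omega
  nlinarith

lemma FF_pos (R : Rect) (h : ((0:ℝ),(0:ℝ)) ∈ R.carrier) : 0 < (FF R).card :=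
  Finset.card_pos.2 ⟨(0,0), (mem_FF R _).2 (by simpa [latticePts] using h)⟩

lemma ergAvg_eq {X : Type*} [MeasurableSpace X] (S T : X ≃ᵐ X) (R : Rect) (f : X → ℝ) (x : X) :
    ergAvg S T R f x = ((FF R).card : ℝ)⁻¹ *
      ∑ p ∈ FF R, f ((S.toEquiv ^ p.1) ((T.toEquiv ^ p.2) x)) := by
  unfold ergAvg latticeCount
  rw [finsum_mem_eq_finite_toFinset_sum _ (lattice_finite R),
    Set.ncard_eq_toFinset_card _ (lattice_finite R)]
  rfl

lemma ratio_tendsto (R : ℕ → Rect) (hR : IsProcess R) :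
    Tendsto (fun n => ((FF (R n)).card : ℝ)⁻¹ * (BB (R n)).card) atTop (𝓝 0) := by
  rw [Metric.tendsto_atTop]
  intro ε hε
  obtain ⟨K, hK⟩ := exists_nat_gt (4 / ε)
  obtain ⟨N, hN⟩ := (tendsto_atTop.1 hR.2 (4 * ((K:ℝ) + 1))).exists_forall_of_atTop
  refine ⟨N, fun n hn => ?_⟩
  have h1 := BB_card (R n) K (hN n hn)
  have h2 : (0:ℝ) < (FF (R n)).card := by exact_mod_cast FF_pos (R n) (hR.1 n)
  have h3 : ((BB (R n)).card : ℝ) * K ≤ 4 * (FF (R n)).card := by exact_mod_cast h1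
  have hK0 : (0:ℝ) < K := lt_trans (by positivity) hK
  rw [Real.dist_eq, sub_zero, abs_of_nonneg (by positivity), inv_mul_lt_iff₀ h2]
  rw [div_lt_iff₀ hε] at hK
  have : ((BB (R n)).card : ℝ) * K < (FF (R n)).card * ε * K := by nlinarith
  exact lt_of_mul_lt_mul_right this hK0.le

lemma sum_shift (R : Rect) (u : ℤ × ℤ → ℝ) (C : ℝ) (hu : ∀ q, |u q| ≤ C) :
    |∑ q ∈ FF R, u (q.1, q.2 + 1) - ∑ q ∈ FF R, u q| ≤ 2 * C * (BB R).card := by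
  classical
  set e : ℤ × ℤ ↪ ℤ × ℤ := ⟨fun q => (q.1, q.2 + 1), fun a b h => by
    simp only [Prod.mk.injEq] at h; exact Prod.ext h.1 (by omega)⟩ with he
  have h1 : ∑ q ∈ FF R, u (q.1, q.2 + 1) = ∑ q ∈ (FF R).map e, u q := by
    rw [Finset.sum_map]; rfl
  have hb : (FF R).map e \ FF R = (BB R).map e := by
    ext q
    simp only [Finset.mem_sdiff, Finset.mem_map, BB, Finset.mem_filter]
    constructor
    · rintro ⟨⟨a, ha, rfl⟩, hq⟩
      exact ⟨a, ⟨ha, hq⟩, rfl⟩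
    · rintro ⟨a, ⟨ha, hq⟩, rfl⟩
      exact ⟨⟨a, ha, rfl⟩, hq⟩
  have c1 : ((FF R).map e \ FF R).card = (BB R).card := by rw [hb, Finset.card_map]
  have c2 : (FF R \ (FF R).map e).card = (BB R).card := by
    rw [← c1]; exact (Finset.card_sdiff_comm (Finset.card_map e)).symm
  rw [h1, ← Finset.sum_sdiff_sub_sum_sdiff]
  have b : ∀ s : Finset (ℤ × ℤ), |∑ q ∈ s, u q| ≤ s.card * C := fun s => by
    calc |∑ q ∈ s, u q| ≤ ∑ q ∈ s, |u q| := Finset.abs_sum_le_sum_abs _ _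
      _ ≤ ∑ q ∈ s, C := Finset.sum_le_sum fun q _ => hu q
      _ = s.card * C := by simp
  have b1 := b ((FF R).map e \ FF R)
  have b2 := b (FF R \ (FF R).map e)
  rw [c1] at b1
  rw [c2] at b2
  have := abs_sub (∑ q ∈ (FF R).map e \ FF R, u q) (∑ q ∈ FF R \ (FF R).map e, u q)
  linarith

lemma mp_zpow {X : Type*} [MeasurableSpace X] {μ : Measure X} (S : X ≃ᵐ X)
    (h : MeasurePreserving (⇑S) μ μ) (i : ℤ) : MeasurePreserving (⇑(S.toEquiv ^ i)) μ μ := by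
  have hnat : ∀ (e : Equiv.Perm X), MeasurePreserving (⇑e) μ μ → ∀ n : ℕ,
      MeasurePreserving (⇑(e ^ n)) μ μ := by
    intro e he n
    induction n with
    | zero => simpa using MeasurePreserving.id μ
    | succ n ih => rw [pow_succ, Equiv.Perm.coe_mul]; exact ih.comp he
  cases i with
  | ofNat n => simpa using hnat S.toEquiv h n
  | negSucc n =>
    rw [zpow_negSucc, ← inv_pow]
    exact hnat _ (MeasurePreserving.symm S h) _

lemma mp_act {X : Type*} [MeasurableSpace X] {μ : Measure X} {S T : X ≃ᵐ X}
    (h : ErgodicSetup μ S T) (q : ℤ × ℤ) :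
    MeasurePreserving (fun x => (S.toEquiv ^ q.1) ((T.toEquiv ^ q.2) x)) μ μ :=
  (mp_zpow S h.measPres_S q.1).comp (mp_zpow T h.measPres_T q.2)

lemma ergAvg_fun {X : Type*} [MeasurableSpace X] (S T : X ≃ᵐ X) (R : Rect) (f : X → ℝ) :
    ergAvg S T R f = ((FF R).card : ℝ)⁻¹ •
      ∑ p ∈ FF R, f ∘ (fun x => (S.toEquiv ^ p.1) ((T.toEquiv ^ p.2) x)) := by
  funext x
  rw [ergAvg_eq]; simp [Finset.sum_apply]

lemma avg_aesm {X : Type*} [MeasurableSpace X] {μ : Measure X} {S T : X ≃ᵐ X}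
    (h : ErgodicSetup μ S T) (R : Rect) (f : X → ℝ) (hf : AEStronglyMeasurable f μ) :
    AEStronglyMeasurable (ergAvg S T R f) μ := by
  rw [ergAvg_fun]
  refine AEStronglyMeasurable.const_smul
    (Finset.aestronglyMeasurable_sum _ fun p _ => ?_) _
  exact hf.comp_measurePreserving (mp_act h p)

lemma avg_norm {X : Type*} [MeasurableSpace X] {μ : Measure X} {S T : X ≃ᵐ X}
    (h : ErgodicSetup μ S T) (R : Rect) (hR : ((0:ℝ),(0:ℝ)) ∈ R.carrier)
    (f : X → ℝ) (hf : AEStronglyMeasurable f μ) :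
    eLpNorm (ergAvg S T R f) 1 μ ≤ eLpNorm f 1 μ := by
  rw [ergAvg_fun, eLpNorm_const_smul]
  have h1 : eLpNorm (∑ p ∈ FF R, f ∘ (fun x => (S.toEquiv ^ p.1) ((T.toEquiv ^ p.2) x))) 1 μ
      ≤ (FF R).card * eLpNorm f 1 μ := by
    refine (eLpNorm_sum_le (fun p _ => hf.comp_measurePreserving (mp_act h p)) le_rfl).trans ?_
    rw [Finset.sum_congr rfl fun p _ => eLpNorm_comp_measurePreserving hf (mp_act h p)]
    simp
  have hpos : ((FF R).card : ℝ) ≠ 0 := by exact_mod_cast (FF_pos R hR).ne'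
  have hne : ((FF R).card : ℝ≥0∞) ≠ 0 := by exact_mod_cast (FF_pos R hR).ne'
  calc _ ≤ ‖((FF R).card : ℝ)⁻¹‖ₑ * ((FF R).card * eLpNorm f 1 μ) := by gcongr
    _ = eLpNorm f 1 μ := by
      rw [enorm_inv hpos, ← mul_assoc]
      have : ‖((FF R).card : ℝ)‖ₑ = ((FF R).card : ℝ≥0∞) := by
        rw [Real.enorm_eq_ofReal (by positivity)]; simp
      rw [this, ENNReal.inv_mul_cancel hne (by simp), one_mul]

lemma avg_integral {X : Type*} [MeasurableSpace X] {μ : Measure X} {S T : X ≃ᵐ X}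
    (h : ErgodicSetup μ S T) (R : Rect) (hR : ((0:ℝ),(0:ℝ)) ∈ R.carrier)
    (f : X → ℝ) (hf : Integrable f μ) :
    ∫ x, ergAvg S T R f x ∂μ = ∫ x, f x ∂μ := by
  simp_rw [ergAvg_eq]
  have hpos : ((FF R).card : ℝ) ≠ 0 := by exact_mod_cast (FF_pos R hR).ne'
  have hint : ∀ p ∈ FF R, Integrable (fun x => f ((S.toEquiv ^ p.1) ((T.toEquiv ^ p.2) x))) μ :=
    fun p _ => (mp_act h p).integrable_comp_of_integrable hf
  rw [integral_const_mul, integral_finsetSum _ hint]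
  have : ∀ p ∈ FF R, ∫ x, f ((S.toEquiv ^ p.1) ((T.toEquiv ^ p.2) x)) ∂μ = ∫ x, f x ∂μ := by
    intro p _
    have hm := mp_act h p
    have h2 := integral_map (μ := μ) (f := f) hm.aemeasurable
      (by rw [hm.map_eq]; exact hf.aestronglyMeasurable)
    rw [hm.map_eq] at h2
    exact h2.symm
  rw [Finset.sum_congr rfl this]
  simp [hpos]

lemma avg_bound {X : Type*} [MeasurableSpace X] {S T : X ≃ᵐ X}
    (R : Rect) (hR : ((0:ℝ),(0:ℝ)) ∈ R.carrier)
    (f : X → ℝ) (C : ℝ) (hf : ∀ x, |f x| ≤ C) (x : X) : |ergAvg S T R f x| ≤ C := by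
  rw [ergAvg_eq, abs_mul, abs_inv, Nat.abs_cast]
  have hpos : (0:ℝ) < (FF R).card := by exact_mod_cast (FF_pos R hR)
  rw [inv_mul_le_iff₀ hpos]
  calc _ ≤ ∑ p ∈ FF R, |f ((S.toEquiv ^ p.1) ((T.toEquiv ^ p.2) x))| :=
        Finset.abs_sum_le_sum_abs _ _
    _ ≤ ∑ p ∈ FF R, C := Finset.sum_le_sum fun p _ => hf _
    _ = _ := by simp

lemma avg_sub {X : Type*} [MeasurableSpace X] (S T : X ≃ᵐ X) (R : Rect) (f g : X → ℝ) (x : X) :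
    ergAvg S T R (f - g) x = ergAvg S T R f x - ergAvg S T R g x := by
  simp only [ergAvg_eq, Pi.sub_apply, Finset.sum_sub_distrib, mul_sub]

lemma avg_shift {X : Type*} [MeasurableSpace X] (S T : X ≃ᵐ X)
    (R : Rect) (f : X → ℝ) (C : ℝ) (hf : ∀ x, |f x| ≤ C) (x : X) :
    |ergAvg S T R f (T x) - ergAvg S T R f x| ≤
      2 * C * (((FF R).card : ℝ)⁻¹ * (BB R).card) := by
  rw [ergAvg_eq, ergAvg_eq, ← mul_sub, abs_mul, abs_inv, Nat.abs_cast]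
  have h := sum_shift R (fun q => f ((S.toEquiv ^ q.1) ((T.toEquiv ^ q.2) x))) C (fun q => hf _)
  have e : ∀ q : ℤ, (T.toEquiv ^ q) (T x) = (T.toEquiv ^ (q + 1)) x := fun q => by
    rw [zpow_add_one, Equiv.Perm.mul_apply]; rfl
  simp only [e]
  calc _ ≤ ((FF R).card : ℝ)⁻¹ * (2 * C * (BB R).card) := by
        exact mul_le_mul_of_nonneg_left h (by positivity)
    _ = _ := by ring

lemma bounded_case {X : Type*} [MeasurableSpace X] {μ : Measure X} {S T : X ≃ᵐ X}
    (h : ErgodicSetup μ S T) (R : ℕ → Rect) (hR : IsProcess R)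
    (f : X → ℝ) (hfm : AEStronglyMeasurable f μ) (C : ℝ) (hf : ∀ x, |f x| ≤ C)
    (hc : AEConverges μ S T R f) :
    ∀ᵐ x ∂μ, Tendsto (fun n => ergAvg S T (R n) f x) atTop (𝓝 (∫ y, f y ∂μ)) := by
  have := h.prob
  obtain ⟨F, hFm, hF⟩ := measurable_limit_of_tendsto_metrizable_ae
    (fun n => (avg_aesm h (R n) f hfm).aemeasurable) hc
  have hFT := h.measPres_T.quasiMeasurePreserving.ae hF
  have hinv : F ∘ T =ᵐ[μ] F := by
    filter_upwards [hF, hFT] with x hx hTx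
    have h1 := hTx.sub hx
    have h2 : Tendsto (fun n => ergAvg S T (R n) f (T x) - ergAvg S T (R n) f x) atTop (𝓝 0) := by
      apply squeeze_zero_norm (fun n => avg_shift S T (R n) f C hf x)
      simpa using (ratio_tendsto R hR).const_mul (2 * C)
    exact sub_eq_zero.1 (tendsto_nhds_unique h1 h2)
  obtain ⟨c, hcF⟩ := h.erg_T.ae_eq_const_of_ae_eq_comp_ae hFm.aestronglyMeasurable hinv
  have hlim := tendsto_integral_of_dominated_convergence (μ := μ) (fun _ => C)
    (fun n => avg_aesm h (R n) f hfm) (integrable_const C)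
    (fun n => Eventually.of_forall fun x => avg_bound (S := S) (T := T) (R n) (hR.1 n) f C hf x) hF
  have hfi : Integrable f μ := Integrable.of_bound hfm C (Eventually.of_forall hf)
  have e1 : ∀ n, ∫ x, ergAvg S T (R n) f x ∂μ = ∫ x, f x ∂μ :=
    fun n => avg_integral h (R n) (hR.1 n) f hfi
  simp only [e1] at hlim
  have e2 : ∫ x, F x ∂μ = c := by
    rw [integral_congr_ae hcF]; simp
  have e3 : ∫ x, f x ∂μ = c := (tendsto_nhds_unique tendsto_const_nhds hlim).trans e2
  filter_upwards [hF, hcF] with x hx hcx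
  rw [e3]
  simpa [hcx] using hx

/-- if `{R_n}` is a `p`-good process, then for every `f ∈ L^p(X)` the
averages `M_n f` converge a.e. to `∫ f dμ`. -/
theorem stmt19 {X : Type} [MeasurableSpace X] (μ : Measure X) (S T : X ≃ᵐ X)
    (hsetup : ErgodicSetup μ S T) (R : ℕ → Rect) (hR : IsProcess R)
    (p : ℝ) (hp : 1 ≤ p) (hgood : IsGoodProcess R (ENNReal.ofReal p)) :
    ∀ f : X → ℝ, MemLp f (ENNReal.ofReal p) μ →
      ∀ᵐ x ∂μ, Tendsto (fun n => ergAvg S T (R n) f x) atTop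
        (𝓝 (∫ y, f y ∂μ)) := by
  intro f hf
  have := hsetup.prob
  have hp1 : (1 : ℝ≥0∞) ≤ ENNReal.ofReal p := by simpa using ENNReal.ofReal_le_ofReal hp
  have hf1 : MemLp f 1 μ := hf.mono_exponent hp1
  have hfi : Integrable f μ := memLp_one_iff_integrable.1 hf1
  obtain ⟨F, hFm, hF⟩ := measurable_limit_of_tendsto_metrizable_ae
    (fun n => (avg_aesm hsetup (R n) f hf.1).aemeasurable) (hgood X μ S T hsetup f hf)
  have key : ∀ ε : ℝ≥0∞, 0 < ε →
      eLpNorm (F - fun _ => ∫ y, f y ∂μ) 1 μ ≤ ε := by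
    intro ε hε
    have hε2 : ε / 2 ≠ 0 := (ENNReal.half_pos hε.ne').ne'
    obtain ⟨g, hg, hg1⟩ := hf1.exists_simpleFunc_eLpNorm_sub_lt (by simp) hε2
    obtain ⟨C, hC⟩ := g.exists_forall_norm_le
    have hgp : MemLp g (ENNReal.ofReal p) μ :=
      MemLp.of_bound g.aestronglyMeasurable C (Eventually.of_forall hC)
    have hgi : Integrable g μ := memLp_one_iff_integrable.1 hg1
    have hgl := bounded_case hsetup R hR g g.aestronglyMeasurable C hC
      (hgood X μ S T hsetup g hgp)
    have hsub : AEStronglyMeasurable (f - ⇑g) μ := hf.1.sub g.aestronglyMeasurable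
    have hlim : ∀ᵐ x ∂μ, Tendsto (fun n => ergAvg S T (R n) (f - ⇑g) x) atTop
        (𝓝 ((F - fun _ : X => ∫ y, g y ∂μ : X → ℝ) x)) := by
      filter_upwards [hF, hgl] with x hx hgx
      simp only [avg_sub]
      exact hx.sub hgx
    have h1 : eLpNorm (F - fun _ => ∫ y, g y ∂μ) 1 μ ≤ ε / 2 := by
      refine (Lp.eLpNorm_lim_le_liminf_eLpNorm
        (fun n => avg_aesm hsetup (R n) (f - ⇑g) hsub) _ hlim).trans ?_
      refine liminf_le_of_le (by isBoundedDefault) fun b hb => ?_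
      obtain ⟨n, hn⟩ := hb.exists
      exact (hn.trans (avg_norm hsetup (R n) (hR.1 n) _ hsub)).trans hg.le
    have h2 : eLpNorm (fun _ : X => ∫ y, g y ∂μ - ∫ y, f y ∂μ) 1 μ ≤ ε / 2 := by
      rw [eLpNorm_const _ (by simp) (NeZero.ne μ)]
      simp only [measure_univ, ENNReal.one_rpow, mul_one]
      rw [← integral_sub hgi hfi]
      refine (enorm_integral_le_lintegral_enorm _).trans ?_
      rw [eLpNorm_one_eq_lintegral_enorm] at hg
      refine le_trans (le_of_eq ?_) hg.le
      refine lintegral_congr fun x => ?_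
      rw [← enorm_neg]; simp
    have e : (F - fun _ => ∫ y, f y ∂μ) = (F - fun _ => ∫ y, g y ∂μ) +
        (fun _ : X => ∫ y, g y ∂μ - ∫ y, f y ∂μ) := by
      funext x; simp
    rw [e]
    refine (eLpNorm_add_le (hFm.aestronglyMeasurable.sub aestronglyMeasurable_const)
      aestronglyMeasurable_const le_rfl).trans ?_
    exact (add_le_add h1 h2).trans (ENNReal.add_halves ε).le
  have h0 : eLpNorm (F - fun _ => ∫ y, f y ∂μ) 1 μ = 0 :=
    le_antisymm (le_of_forall_gt fun ε hε => by
      obtain ⟨d, hd, hd'⟩ := exists_between hε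
      exact (key d hd).trans_lt hd') bot_le
  rw [eLpNorm_eq_zero_iff (hFm.aestronglyMeasurable.sub aestronglyMeasurable_const) (by simp)] at h0
  filter_upwards [hF, h0] with x hx hx0
  have : F x = ∫ y, f y ∂μ := sub_eq_zero.1 hx0
  rwa [this] at hx

end
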